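/- arXiv:2603.00673 — 2 statements merged into one kernel-verified Lean document; each statement's English description precedes it below -/
import Mathlib

section
/- Let p be a positive integer. Then ∑_{n=0}^{∞} ζ(2n)/((2n+p)·2^{2n}) = -(1/2)·log 2 - ∑_{k=1}^{⌊p/2⌋} p!·(-1)^k·(4^k - 1)·ζ(2k+1) / (2·(p-2k)!·(2π)^{2k}) - δ_{⌊p/2⌋, p/2} · p!·(-1)^{p/2}·ζ(p+1)/(2π^p). -/
open Real Complex

/-- The alternating harmonic series sums (conditionally) to `-log 2`. -/
theorem tendsto_sum_alternating_harmonic :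
    Filter.Tendsto (fun N : ℕ => ∑ k ∈ Finset.range N, (-1 : ℝ) ^ (k + 1) / (k + 1 : ℝ))
      Filter.atTop (nhds (-Real.log 2)) := by
  have hanti : Antitone (fun k : ℕ => 1 / ((k : ℝ) + 1)) := fun a b h =>
    one_div_le_one_div_of_le (by positivity) (by gcongr)
  obtain ⟨l, hl⟩ := hanti.tendsto_alternating_series_of_tendsto_zero
    tendsto_one_div_add_atTop_nhds_zero_nat
  have hneg : Filter.Tendsto (fun N : ℕ => ∑ k ∈ Finset.range N, (-1 : ℝ) ^ (k + 1) / (k + 1 : ℝ))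
      Filter.atTop (nhds (-l)) := by
    refine hl.neg.congr fun N => ?_
    rw [← Finset.sum_neg_distrib]
    refine Finset.sum_congr rfl fun k _ => ?_
    rw [pow_succ]; ring
  have habel := Real.tendsto_tsum_powerSeries_nhdsWithin_lt hneg
  have hid : Filter.Tendsto (fun x : ℝ => x) (nhdsWithin 1 (Set.Iio 1)) (nhds 1) :=
    Filter.tendsto_id.mono_left nhdsWithin_le_nhds
  have hlog : Filter.Tendsto (fun x : ℝ => -Real.log (1 + x)) (nhdsWithin 1 (Set.Iio 1))
      (nhds (-Real.log (1 + 1))) :=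
    ((hid.const_add 1).log (by norm_num)).neg
  have heq : -l = -Real.log (1 + 1) := by
    refine tendsto_nhds_unique ?_ hlog
    have := hid.mul habel
    rw [one_mul] at this
    refine this.congr' ?_
    filter_upwards [Ioo_mem_nhdsLT (show (0 : ℝ) < 1 by norm_num)] with x hx
    have hs := Real.hasSum_pow_div_log_of_abs_lt_one (x := -x) (by
      rw [abs_neg, abs_of_pos hx.1]; exact hx.2)
    rw [sub_neg_eq_add] at hs
    rw [← hs.tsum_eq, ← tsum_mul_left]
    refine tsum_congr fun n => ?_
    rw [neg_pow x]
    ring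
  rw [heq] at hneg
  convert! hneg using 2
  norm_num

theorem hasSum_one_div_nat_pow_riemannZeta {s : ℕ} (hs : 1 < s) :
    HasSum (fun n : ℕ => 1 / (n : ℂ) ^ s) (riemannZeta s) := by
  rw [zeta_nat_eq_tsum_of_gt_one hs]
  refine Summable.hasSum (Summable.of_norm ?_)
  simpa using Real.summable_one_div_nat_pow.2 hs

/-- The Dirichlet eta function at natural numbers, in terms of the zeta function. -/
theorem hasSum_alternating_zeta {s : ℕ} (hs : 1 < s) :
    HasSum (fun k : ℕ => (-1 : ℂ) ^ (k + 1) / (k + 1 : ℂ) ^ s)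
      (-(1 - 2 / 2 ^ s) * riemannZeta s) := by
  have hsum := hasSum_one_div_nat_pow_riemannZeta hs
  have heven : HasSum (fun n : ℕ => 1 / ((2 * n : ℕ) : ℂ) ^ s) (1 / 2 ^ s * riemannZeta s) := by
    convert! hsum.mul_left (1 / 2 ^ s) using 2 with n
    push_cast
    rw [mul_pow]
    ring
  have hinj : Function.Injective (fun n : ℕ => 2 * n + 1) := fun a b h => by
    simpa using h
  have hodd' : Summable (fun n : ℕ => 1 / ((2 * n + 1 : ℕ) : ℂ) ^ s) :=
    hsum.summable.comp_injective hinj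
  have hodd : HasSum (fun n : ℕ => 1 / ((2 * n + 1 : ℕ) : ℂ) ^ s)
      (riemannZeta s - 1 / 2 ^ s * riemannZeta s) := by
    have := (HasSum.even_add_odd (f := fun n : ℕ => 1 / (n : ℂ) ^ s) heven hodd'.hasSum).unique hsum
    rw [← eq_sub_of_add_eq' this]
    exact hodd'.hasSum
  have halt : HasSum (fun n : ℕ => (-1 : ℂ) ^ n / (n : ℂ) ^ s)
      (1 / 2 ^ s * riemannZeta s + -(riemannZeta s - 1 / 2 ^ s * riemannZeta s)) := by
    refine HasSum.even_add_odd (f := fun n : ℕ => (-1 : ℂ) ^ n / (n : ℂ) ^ s) ?_ ?_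
    · convert! heven using 2 with n
      simp
    · convert! hodd.neg using 2 with n
      rw [pow_succ, pow_mul]
      simp
      ring
  have := (hasSum_nat_add_iff' 1).2 halt
  convert! this using 1
  · push_cast; rfl
  · simp [show s ≠ 0 by omega]
    ring

theorem hasSum_one_div_nat_add_one_pow_riemannZeta {s : ℕ} (hs : 1 < s) :
    HasSum (fun k : ℕ => 1 / (k + 1 : ℂ) ^ s) (riemannZeta s) := by
  have hsum := hasSum_one_div_nat_pow_riemannZeta hs
  have := (hasSum_nat_add_iff' 1).2 hsum
  convert! this using 1
  · push_cast; rfl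
  · simp [show s ≠ 0 by omega]

/-- The power series of `-(π x / 2) cot (π x)` on `(0, 1)`. -/
theorem hasSum_riemannZeta_two_mul_mul_pow {x : ℝ} (hx0 : 0 < x) (hx1 : x < 1) :
    HasSum (fun n : ℕ => riemannZeta (2 * n) * (x : ℂ) ^ (2 * n))
      (-(π * x / 2) * Complex.cot (π * x)) := by
  have hmem : (x : ℂ) ∈ integerComplement := by
    rw [Complex.mem_integerComplement_iff]
    rintro ⟨n, hn⟩
    have hn' : (n : ℝ) = x := by exact_mod_cast hn
    rw [← hn'] at hx0 hx1
    have h0 : 0 < n := by exact_mod_cast hx0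
    have h1 : n < 1 := by exact_mod_cast hx1
    omega
  have hx2 : x ^ 2 < 1 := by nlinarith
  have hsummable : Summable fun q : ℕ × ℕ => ((x : ℂ) ^ 2 / (q.1 + 1 : ℂ) ^ 2) ^ (q.2 + 1) := by
    have hf : Summable fun m : ℕ => 1 / ((m : ℝ) + 1) ^ 2 := by
      have := (summable_nat_add_iff 1).2 (Real.summable_one_div_nat_pow.2 one_lt_two)
      exact_mod_cast this
    have hg : Summable fun n : ℕ => (x ^ 2) ^ (n + 1) :=
      (summable_nat_add_iff 1).2 (summable_geometric_of_lt_one (by positivity) hx2)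
    refine Summable.of_norm_bounded
      (hf.mul_of_nonneg hg (fun _ => by positivity) (fun _ => by positivity)) ?_
    rintro ⟨m, n⟩
    have hm : ‖(m + 1 : ℂ)‖ = (m : ℝ) + 1 := by
      exact_mod_cast Complex.norm_natCast (m + 1)
    simp only [norm_pow, norm_div, Complex.norm_real, hm, Real.norm_eq_abs, abs_of_pos hx0]
    rw [div_pow, div_eq_mul_one_div, mul_comm]
    gcongr
    rw [← pow_mul]
    exact pow_le_pow_right₀ (by linarith [(Nat.cast_nonneg m : (0 : ℝ) ≤ m)]) (by omega)
  have hrow (m : ℕ) : HasSum (fun n : ℕ => ((x : ℂ) ^ 2 / (m + 1 : ℂ) ^ 2) ^ (n + 1))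
      (-(x / 2) * (1 / ((x : ℂ) - (m + 1)) + 1 / (x + (m + 1)))) := by
    have hlt : ‖(x : ℂ) ^ 2 / (m + 1 : ℂ) ^ 2‖ < 1 := by
      have hm : ‖(m + 1 : ℂ)‖ = (m : ℝ) + 1 := by
        exact_mod_cast Complex.norm_natCast (m + 1)
      simp only [norm_pow, norm_div, Complex.norm_real, hm, Real.norm_eq_abs, abs_of_pos hx0]
      rw [div_lt_one (by positivity)]
      nlinarith [(Nat.cast_nonneg m : (0 : ℝ) ≤ m)]
    have hmr : (0 : ℝ) ≤ m := Nat.cast_nonneg m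
    have h1 : (x : ℂ) - (m + 1) ≠ 0 := by
      exact_mod_cast (show x - (m + 1) ≠ 0 by linarith)
    have h2 : (x : ℂ) + (m + 1) ≠ 0 := by
      exact_mod_cast (show x + (m + 1) ≠ 0 by linarith)
    have h3 : (m + 1 : ℂ) ≠ 0 := by exact_mod_cast Nat.succ_ne_zero m
    have h4 : (m + 1 : ℂ) ^ 2 - x ^ 2 ≠ 0 := by
      rw [show (m + 1 : ℂ) ^ 2 - x ^ 2 = -((x - (m + 1)) * (x + (m + 1))) by ring]
      exact neg_ne_zero.2 (mul_ne_zero h1 h2)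
    have hgeo := (hasSum_geometric_of_norm_lt_one hlt).mul_left ((x : ℂ) ^ 2 / (m + 1 : ℂ) ^ 2)
    convert! hgeo using 1
    · exact funext fun n => pow_succ' _ n
    · rw [one_sub_div (pow_ne_zero 2 h3), inv_div, div_mul_div_cancel₀ (pow_ne_zero 2 h3),
        div_add_div _ _ h1 h2, ← mul_div_assoc, div_eq_div_iff (mul_ne_zero h1 h2) h4]
      ring
  have hcol (n : ℕ) : HasSum (fun m : ℕ => ((x : ℂ) ^ 2 / (m + 1 : ℂ) ^ 2) ^ (n + 1))
      (riemannZeta (2 * (n + 1 : ℕ)) * (x : ℂ) ^ (2 * (n + 1))) := by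
    convert! (hasSum_one_div_nat_add_one_pow_riemannZeta (s := 2 * (n + 1)) (by omega)).mul_right
      ((x : ℂ) ^ (2 * (n + 1))) using 2 with m
    · rw [div_pow, ← pow_mul, ← pow_mul]; ring
    · push_cast; rfl
  have hm := hsummable.hasSum.prod_fiberwise hrow
  have hn := ((Equiv.prodComm ℕ ℕ).hasSum_iff.2 hsummable.hasSum).prod_fiberwise hcol
  have hcot : HasSum (fun m : ℕ => -((x : ℂ) / 2) * (1 / ((x : ℂ) - (m + 1)) + 1 / (x + (m + 1))))
      (-(x / 2) * (π * Complex.cot (π * x) - 1 / x)) := by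
    rw [cot_series_rep' hmem]
    exact (summable_cotTerm hmem).hasSum.mul_left _
  rw [hm.unique hcot] at hn
  rw [← hasSum_nat_add_iff' 1]
  convert! hn using 1
  have : (x : ℂ) ≠ 0 := by exact_mod_cast hx0.ne'
  simp [riemannZeta_zero]
  field_simp
  ring

theorem integral_pow_succ_mul_sin_mul (p : ℕ) {c : ℝ} (hc : c ≠ 0) (b : ℝ) :
    ∫ x in (0 : ℝ)..b, x ^ (p + 1) * Real.sin (c * x) =
      -(b ^ (p + 1) * Real.cos (c * b)) / c
        + (p + 1) / c * ∫ x in (0 : ℝ)..b, x ^ p * Real.cos (c * x) := by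
  have hv (x : ℝ) : HasDerivAt (fun x => -Real.cos (c * x) / c) (Real.sin (c * x)) x := by
    have := (((hasDerivAt_id x).const_mul c).cos.neg).div_const c
    convert! this using 1
    simp; field_simp
  have hu (x : ℝ) : HasDerivAt (fun x : ℝ => x ^ (p + 1)) ((p + 1) * x ^ p) x := by
    simpa using hasDerivAt_pow (p + 1) x
  rw [intervalIntegral.integral_mul_deriv_eq_deriv_mul (fun x _ => hu x) (fun x _ => hv x)
    (by apply Continuous.intervalIntegrable; fun_prop)
    (by apply Continuous.intervalIntegrable; fun_prop), ← intervalIntegral.integral_const_mul,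
    sub_eq_add_neg, ← intervalIntegral.integral_neg]
  congr 1
  · simp; ring
  · refine intervalIntegral.integral_congr fun x _ => ?_
    ring

theorem integral_pow_succ_mul_cos_mul (p : ℕ) {c : ℝ} (hc : c ≠ 0) (b : ℝ) :
    ∫ x in (0 : ℝ)..b, x ^ (p + 1) * Real.cos (c * x) =
      b ^ (p + 1) * Real.sin (c * b) / c
        - (p + 1) / c * ∫ x in (0 : ℝ)..b, x ^ p * Real.sin (c * x) := by
  have hv (x : ℝ) : HasDerivAt (fun x => Real.sin (c * x) / c) (Real.cos (c * x)) x := by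
    have := (((hasDerivAt_id x).const_mul c).sin).div_const c
    convert! this using 1
    simp; field_simp
  have hu (x : ℝ) : HasDerivAt (fun x : ℝ => x ^ (p + 1)) ((p + 1) * x ^ p) x := by
    simpa using hasDerivAt_pow (p + 1) x
  rw [intervalIntegral.integral_mul_deriv_eq_deriv_mul (fun x _ => hu x) (fun x _ => hv x)
    (by apply Continuous.intervalIntegrable; fun_prop)
    (by apply Continuous.intervalIntegrable; fun_prop), ← intervalIntegral.integral_const_mul]
  congr 1
  · simp; ring
  · refine intervalIntegral.integral_congr fun x _ => ?_
    ring

theorem integral_pow_mul_sin_two_pi_nat_mul (p : ℕ) {k : ℕ} (hk : k ≠ 0) :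
    ∫ x in (0 : ℝ)..(1 / 2), x ^ p * Real.sin (2 * π * k * x) =
      -∑ j ∈ Finset.range (p / 2 + 1), (-1) ^ j * (Nat.factorial p : ℝ) /
          (Nat.factorial (p - 2 * j)) * (1 / 2) ^ (p - 2 * j) * (-1) ^ k / (2 * π * k) ^ (2 * j + 1)
        + if Even p then (-1) ^ (p / 2) * (Nat.factorial p : ℝ) / (2 * π * k) ^ (p + 1) else 0 := by
  have hc : 2 * π * (k : ℝ) ≠ 0 := by positivity
  have hcos : Real.cos (2 * π * k * (1 / 2)) = (-1) ^ k := by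
    rw [← Real.cos_nat_mul_pi]; congr 1; ring
  have hsin : Real.sin (2 * π * k * (1 / 2)) = 0 := by
    rw [← Real.sin_nat_mul_pi k]; congr 1; ring
  induction p using Nat.twoStepInduction with
  | zero =>
    have : ∫ x in (0 : ℝ)..(1 / 2), x ^ 0 * Real.sin (2 * π * k * x)
        = (1 - (-1) ^ k) / (2 * π * k) := by
      simp only [pow_zero, one_mul]
      rw [intervalIntegral.integral_comp_mul_left (fun x => Real.sin x) hc, integral_sin, hcos]
      simp
      ring
    rw [this]
    simp
    ring
  | one =>
    have h := integral_pow_succ_mul_sin_mul 0 hc (1 / 2)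
    have h0 : ∫ x in (0 : ℝ)..(1 / 2), x ^ 0 * Real.cos (2 * π * k * x) = 0 := by
      simp only [pow_zero, one_mul]
      rw [intervalIntegral.integral_comp_mul_left (fun x => Real.cos x) hc, integral_cos, hsin]
      simp
    rw [h0, hcos] at h
    simp only [zero_add] at h
    rw [h]
    simp
    ring
  | more p ih _ =>
    rw [integral_pow_succ_mul_sin_mul (p + 1) hc, integral_pow_succ_mul_cos_mul p hc, hsin, hcos,
      ih, show (p + 2) / 2 + 1 = (p / 2 + 1) + 1 by omega, Finset.sum_range_succ' _ (p / 2 + 1)]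
    have hfac : (Nat.factorial (p + 2) : ℝ) = (p + 2) * (p + 1) * Nat.factorial p := by
      rw [Nat.factorial_succ, Nat.factorial_succ]; push_cast; ring
    have hsum : ∑ j ∈ Finset.range (p / 2 + 1), (-1) ^ (j + 1) * (Nat.factorial (p + 2) : ℝ) /
          (Nat.factorial (p + 2 - 2 * (j + 1))) * (1 / 2) ^ (p + 2 - 2 * (j + 1)) * (-1) ^ k
            / (2 * π * k) ^ (2 * (j + 1) + 1) =
        -((p + 2) * (p + 1) / (2 * π * k) ^ 2) *
          ∑ j ∈ Finset.range (p / 2 + 1), (-1) ^ j * (Nat.factorial p : ℝ) /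
          (Nat.factorial (p - 2 * j)) * (1 / 2) ^ (p - 2 * j) * (-1) ^ k
            / (2 * π * k) ^ (2 * j + 1) := by
      rw [Finset.mul_sum]
      refine Finset.sum_congr rfl fun j _ => ?_
      rw [show p + 2 - 2 * (j + 1) = p - 2 * j by omega, hfac]
      field_simp
      ring
    have hdel : (if Even (p + 2) then (-1 : ℝ) ^ ((p + 2) / 2) * (Nat.factorial (p + 2) : ℝ)
          / (2 * π * k) ^ (p + 2 + 1) else 0) =
        -((p + 2) * (p + 1) / (2 * π * k) ^ 2) *
          if Even p then (-1) ^ (p / 2) * (Nat.factorial p : ℝ) / (2 * π * k) ^ (p + 1) else 0 := by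
      by_cases hp : Even p
      · rw [if_pos hp, if_pos (hp.add even_two), hfac, show (p + 2) / 2 = p / 2 + 1 by omega]
        field_simp
        ring
      · rw [if_neg hp, if_neg (by rwa [Nat.even_add, iff_true_right even_two]), mul_zero]
    rw [hsum, hdel]
    generalize (∑ j ∈ Finset.range (p / 2 + 1), _ : ℝ) = S
    generalize (if Even p then _ else (0 : ℝ)) = D
    have hf : (Nat.factorial (p + 2) : ℝ) ≠ 0 := by positivity
    simp only [mul_zero, Nat.sub_zero, pow_zero, one_mul, zero_add, pow_one, zero_div, div_self hf]
    push_cast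
    field_simp
    ring

/-- `x ^ (q + 1) / sin (π x)`, extended continuously to `x = 0`. -/
noncomputable def powDivSin (q : ℕ) (x : ℝ) : ℝ := x ^ q / (π * Real.sinc (π * x))

theorem sinc_pi_mul_pos {x : ℝ} (h0 : 0 ≤ x) (h1 : x < 1) : 0 < Real.sinc (π * x) := by
  rcases h0.eq_or_lt with rfl | h0
  · simp
  · have hpos : 0 < π * x := by positivity
    rw [Real.sinc_of_ne_zero hpos.ne']
    exact div_pos (Real.sin_pos_of_pos_of_lt_pi hpos (by nlinarith [Real.pi_pos])) hpos

theorem powDivSin_mul_sin (q : ℕ) {x : ℝ} (h0 : 0 ≤ x) (h1 : x < 1) :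
    powDivSin q x * Real.sin (π * x) = x ^ (q + 1) := by
  have hs := sinc_pi_mul_pos h0 h1
  have hsin : Real.sin (π * x) = π * x * Real.sinc (π * x) := by
    rcases eq_or_ne x 0 with rfl | hx
    · simp
    · have : π * x ≠ 0 := by positivity
      rw [Real.sinc_of_ne_zero this]; field_simp
  rw [powDivSin, hsin, pow_succ]
  field_simp

theorem continuousOn_powDivSin (q : ℕ) : ContinuousOn (powDivSin q) (Set.Icc 0 (1 / 2)) := by
  refine ContinuousOn.div (by fun_prop) ?_ fun x hx => ?_
  · exact (continuous_const.mul
      (Real.continuous_sinc.comp (continuous_const.mul continuous_id))).continuousOn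
  · exact (mul_pos Real.pi_pos (sinc_pi_mul_pos hx.1 (by linarith [hx.2]))).ne'

/-- The Riemann-Lebesgue lemma for cosine integrals over a compact interval. -/
theorem tendsto_integral_mul_cos_atTop {g : ℝ → ℝ} {a b : ℝ} (hab : a ≤ b)
    (hg : ContinuousOn g (Set.Icc a b)) :
    Filter.Tendsto (fun w : ℝ => ∫ x in a..b, g x * Real.cos (w * x)) Filter.atTop (nhds 0) := by
  have hRL := Real.tendsto_integral_exp_smul_cocompact
    ((Set.Ioc a b).indicator fun x => (g x : ℂ))
  have hw : Filter.Tendsto (fun w : ℝ => w / (2 * π)) Filter.atTop (Filter.cocompact ℝ) :=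
    (Filter.tendsto_id.atTop_div_const (by positivity)).mono_right atTop_le_cocompact
  have := (Complex.continuous_re.tendsto 0).comp (hRL.comp hw)
  rw [Complex.zero_re] at this
  refine this.congr fun w => ?_
  simp only [Function.comp]
  have hind (v : ℝ) : Real.fourierChar (-(v * (w / (2 * π)))) •
      (Set.Ioc a b).indicator (fun x => (g x : ℂ)) v =
      (Set.Ioc a b).indicator
        (fun x => Complex.exp ((-(w * x) : ℝ) * I) * (g x : ℂ)) v := by
    by_cases hv : v ∈ Set.Ioc a b
    · rw [Set.indicator_of_mem hv, Set.indicator_of_mem hv, Circle.smul_def, Real.fourierChar_apply,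
        smul_eq_mul]
      congr 4
      field_simp
    · simp [Set.indicator_of_notMem hv]
  simp_rw [hind]
  rw [MeasureTheory.integral_indicator measurableSet_Ioc, intervalIntegral.integral_of_le hab]
  have hint : MeasureTheory.Integrable (fun x => Complex.exp ((-(w * x) : ℝ) * I) * (g x : ℂ))
      (MeasureTheory.volume.restrict (Set.Ioc a b)) := by
    refine (ContinuousOn.integrableOn_Icc ?_).mono_set Set.Ioc_subset_Icc_self
    fun_prop
  have hre := integral_re hint
  simp only [RCLike.re_to_complex] at hre
  rw [← hre]
  congr 1
  funext x
  rw [Complex.re_mul_ofReal, Complex.exp_ofReal_mul_I_re, Real.cos_neg, mul_comm]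

theorem powDivSin_mul_cos_eq (q N : ℕ) {x : ℝ} (h0 : 0 ≤ x) (h1 : x < 1) :
    powDivSin q x * Real.cos (π * x) =
      2 * ∑ k ∈ Finset.range N, x ^ (q + 1) * Real.sin (2 * π * (k + 1 : ℕ) * x) +
        powDivSin q x * Real.cos ((2 * N + 1) * π * x) := by
  induction N with
  | zero => simp
  | succ N ih =>
    rw [ih, Finset.sum_range_succ, ← powDivSin_mul_sin q h0 h1]
    have hdiff := Real.cos_sub_cos ((2 * N + 1) * π * x) ((2 * (N + 1 : ℕ) + 1) * π * x)
    rw [show ((2 * N + 1) * π * x + (2 * (N + 1 : ℕ) + 1) * π * x) / 2 = 2 * π * (N + 1 : ℕ) * x by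
        push_cast; ring,
      show ((2 * N + 1) * π * x - (2 * (N + 1 : ℕ) + 1) * π * x) / 2 = -(π * x) by push_cast; ring,
      Real.sin_neg] at hdiff
    linear_combination powDivSin q x * hdiff

theorem tendsto_sum_integral_pow_mul_sin (q : ℕ) :
    Filter.Tendsto (fun N : ℕ => 2 * ∑ k ∈ Finset.range N,
        ∫ x in (0 : ℝ)..(1 / 2), x ^ (q + 1) * Real.sin (2 * π * (k + 1 : ℕ) * x)) Filter.atTop
      (nhds (∫ x in (0 : ℝ)..(1 / 2), powDivSin q x * Real.cos (π * x))) := by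
  have hcont := continuousOn_powDivSin q
  have hlin : Filter.Tendsto (fun N : ℕ => (2 * (N : ℝ) + 1) * π) Filter.atTop Filter.atTop :=
    (Filter.tendsto_atTop_add_const_right _ _
      (tendsto_natCast_atTop_atTop.const_mul_atTop two_pos)).atTop_mul_const Real.pi_pos
  have hRL := (tendsto_integral_mul_cos_atTop (by norm_num) hcont).comp hlin
  have := hRL.const_sub (∫ x in (0 : ℝ)..(1 / 2), powDivSin q x * Real.cos (π * x))
  rw [sub_zero] at this
  refine this.congr fun N => ?_
  simp only [Function.comp]
  rw [sub_eq_iff_eq_add, ← intervalIntegral.integral_finsetSum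
    (fun k _ => by apply Continuous.intervalIntegrable; fun_prop),
    ← intervalIntegral.integral_const_mul, ← intervalIntegral.integral_add]
  · refine intervalIntegral.integral_congr fun x hx => ?_
    rw [Set.uIcc_of_le (by norm_num)] at hx
    exact powDivSin_mul_cos_eq q N hx.1 (by linarith [hx.2])
  · apply Continuous.intervalIntegrable; fun_prop
  · refine ContinuousOn.intervalIntegrable_of_Icc (by norm_num) ?_
    fun_prop

theorem hasSum_riemannZeta_two_mul_div (q : ℕ) :
    HasSum (fun n : ℕ => riemannZeta (2 * n) / (((2 * n + (q + 1) : ℕ) : ℂ) * 2 ^ (2 * n)))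
      (-(2 ^ q * π) * (∫ x in (0 : ℝ)..(1 / 2), powDivSin q x * Real.cos (π * x) : ℝ)) := by
  have hterm (n : ℕ) : ∫ x in (0 : ℝ)..(1 / 2),
      riemannZeta (2 * n) * (x : ℂ) ^ (2 * n) * (x : ℂ) ^ q =
      (1 / 2 ^ (q + 1)) *
        (riemannZeta (2 * n) / (((2 * n + (q + 1) : ℕ) : ℂ) * 2 ^ (2 * n))) := by
    have hpow : ∫ x in (0 : ℝ)..(1 / 2), (x : ℂ) ^ (2 * n + q) =
        ((∫ x in (0 : ℝ)..(1 / 2), x ^ (2 * n + q) : ℝ) : ℂ) := by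
      rw [← intervalIntegral.integral_ofReal]
      push_cast
      rfl
    simp_rw [mul_assoc, ← pow_add]
    rw [intervalIntegral.integral_const_mul, hpow, integral_pow]
    have h0 : (2 * n + q + 1 : ℂ) ≠ 0 := by exact_mod_cast Nat.succ_ne_zero (2 * n + q)
    have h1 : (2 * n + (q + 1) : ℂ) ≠ 0 := by rwa [← add_assoc]
    push_cast
    simp only [zero_pow (Nat.succ_ne_zero _), sub_zero, one_div, inv_pow]
    field_simp
    ring
  have hbound : Summable fun n : ℕ => ‖riemannZeta (2 * n) * ((1 / 2 : ℝ) : ℂ) ^ (2 * n)‖ :=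
    (hasSum_riemannZeta_two_mul_mul_pow (x := 1 / 2) (by norm_num) (by norm_num)).summable.norm
  have hint : HasSum (fun n : ℕ => ∫ x in (0 : ℝ)..(1 / 2),
      riemannZeta (2 * n) * (x : ℂ) ^ (2 * n) * (x : ℂ) ^ q)
      (∫ x in (0 : ℝ)..(1 / 2), -((π : ℂ) / 2) * (powDivSin q x * Real.cos (π * x) : ℝ)) := by
    refine intervalIntegral.hasSum_integral_of_dominated_convergence
      (fun n _ => ‖riemannZeta (2 * n) * ((1 / 2 : ℝ) : ℂ) ^ (2 * n)‖) (fun n => ?_)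
      (fun n => ?_) ?_ ?_ ?_
    · exact Continuous.aestronglyMeasurable (by fun_prop)
    · refine Filter.Eventually.of_forall fun x hx => ?_
      rw [Set.uIoc_of_le (by norm_num)] at hx
      have hx1 : |x| ≤ 1 := by rw [abs_of_pos hx.1]; linarith [hx.2]
      simp only [norm_mul, norm_pow, Complex.norm_real, Real.norm_eq_abs]
      refine mul_le_of_le_one_right (by positivity) (pow_le_one₀ (abs_nonneg _) hx1) |>.trans ?_
      rw [abs_of_pos hx.1]
      gcongr
      · exact hx.1.le
      · exact hx.2.trans (le_abs_self _)
    · exact Filter.Eventually.of_forall fun x _ => hbound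
    · exact intervalIntegrable_const
    · refine Filter.Eventually.of_forall fun x hx => ?_
      rw [Set.uIoc_of_le (by norm_num)] at hx
      have hx1 : x < 1 := by linarith [hx.2]
      have hsin : Real.sin (π * x) ≠ 0 :=
        (Real.sin_pos_of_pos_of_lt_pi (by have := hx.1; positivity)
          (by nlinarith [Real.pi_pos])).ne'
      have hval : -((π : ℂ) / 2) * (powDivSin q x * Real.cos (π * x) : ℝ) =
          -(π * x / 2) * Complex.cot (π * x) * (x : ℂ) ^ q := by
        have hg : powDivSin q x = x ^ (q + 1) / Real.sin (π * x) :=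
          eq_div_of_mul_eq hsin (powDivSin_mul_sin q hx.1.le hx1)
        rw [hg, Complex.cot]
        push_cast
        ring
      rw [hval]
      exact (hasSum_riemannZeta_two_mul_mul_pow hx.1 hx1).mul_right _
  simp_rw [hterm] at hint
  rw [intervalIntegral.integral_const_mul, intervalIntegral.integral_ofReal] at hint
  convert! hint.mul_left ((2 : ℂ) ^ (q + 1)) using 1
  · funext n
    field_simp
  · rw [pow_succ]
    ring

theorem tendsto_sum_alternating_odd_pow (j : ℕ) :
    Filter.Tendsto
      (fun N : ℕ => ∑ k ∈ Finset.range N, (-1 : ℂ) ^ (k + 1) / (k + 1 : ℂ) ^ (2 * j + 1))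
      Filter.atTop
      (nhds (if j = 0 then -(Real.log 2 : ℂ)
        else -(1 - 1 / 4 ^ j) * riemannZeta (2 * j + 1))) := by
  split_ifs with hj
  · subst hj
    have := (Complex.continuous_ofReal.tendsto _).comp tendsto_sum_alternating_harmonic
    rw [Complex.ofReal_neg] at this
    refine this.congr fun N => ?_
    simp
  · have := (hasSum_alternating_zeta (s := 2 * j + 1) (by omega)).tendsto_sum_nat
    convert! this using 2
    rw [pow_succ, pow_mul]
    push_cast
    norm_num
    left
    field_simp

theorem tendsto_sum_integral_pow_mul_sin_zeta {p : ℕ} (hp : 0 < p) :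
    Filter.Tendsto (fun N : ℕ => ((∑ k ∈ Finset.range N,
        ∫ x in (0 : ℝ)..(1 / 2), x ^ p * Real.sin (2 * π * (k + 1 : ℕ) * x) : ℝ) : ℂ)) Filter.atTop
      (nhds (-∑ j ∈ Finset.range (p / 2 + 1), (-1) ^ j * (Nat.factorial p : ℂ) /
          (Nat.factorial (p - 2 * j)) * (1 / 2) ^ (p - 2 * j) / (2 * π) ^ (2 * j + 1) *
            (if j = 0 then -(Real.log 2 : ℂ) else -(1 - 1 / 4 ^ j) * riemannZeta (2 * j + 1))
        + if Even p then (-1) ^ (p / 2) * (Nat.factorial p : ℂ) / (2 * π) ^ (p + 1) *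
            riemannZeta (p + 1) else 0)) := by
  have hodd := tendsto_finsetSum (Finset.range (p / 2 + 1)) fun j _ =>
    (tendsto_sum_alternating_odd_pow j).const_mul ((-1) ^ j * (Nat.factorial p : ℂ) /
          (Nat.factorial (p - 2 * j)) * (1 / 2) ^ (p - 2 * j) / (2 * π) ^ (2 * j + 1))
  have heven : Filter.Tendsto (fun N : ℕ => ∑ k ∈ Finset.range N, if Even p then
        (-1) ^ (p / 2) * (Nat.factorial p : ℂ) / (2 * π) ^ (p + 1) * (1 / (k + 1 : ℂ) ^ (p + 1))
        else 0) Filter.atTop (nhds (if Even p then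
        (-1) ^ (p / 2) * (Nat.factorial p : ℂ) / (2 * π) ^ (p + 1) * riemannZeta (p + 1) else 0)) := by
    split_ifs
    · have := ((hasSum_one_div_nat_add_one_pow_riemannZeta (s := p + 1) (by omega)).mul_left
        ((-1) ^ (p / 2) * (Nat.factorial p : ℂ) / (2 * π) ^ (p + 1))).tendsto_sum_nat
      exact_mod_cast this
    · simp
  refine (hodd.neg.add heven).congr fun N => ?_
  simp_rw [Finset.mul_sum]
  rw [Finset.sum_comm, ← Finset.sum_neg_distrib, ← Finset.sum_add_distrib, Complex.ofReal_sum]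
  refine Finset.sum_congr rfl fun k _ => ?_
  rw [integral_pow_mul_sin_two_pi_nat_mul p (Nat.add_one_ne_zero k)]
  push_cast
  congr 2
  · refine Finset.sum_congr rfl fun j _ => ?_
    rw [mul_pow (2 * (π : ℂ)) (k + 1 : ℂ), div_mul_div_comm]
  · split_ifs
    · push_cast
      rw [mul_pow (2 * (π : ℂ)) (k + 1 : ℂ), div_mul_div_comm, mul_one]
    · simp


theorem stmt_6 (p : ℕ) (hp : 0 < p) :
    ∑' n : ℕ, riemannZeta (2 * n) / (((2 * n + p : ℕ) : ℂ) * 2 ^ (2 * n)) =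
      -(1 / 2) * Real.log 2
        - ∑ k ∈ Finset.Icc 1 (p / 2),
            ((Nat.factorial p : ℂ) * (-1) ^ k * (4 ^ k - 1) * riemannZeta (2 * k + 1)) /
              (2 * (Nat.factorial (p - 2 * k) : ℂ) * (2 * (Real.pi : ℂ)) ^ (2 * k))
        - (if Even p then
            ((Nat.factorial p : ℂ) * (-1) ^ (p / 2) * riemannZeta (p + 1)) /
              (2 * (Real.pi : ℂ) ^ p)
          else 0) := by
  obtain ⟨q, rfl⟩ := Nat.exists_eq_succ_of_ne_zero hp.ne'
  have hlim := (Complex.continuous_ofReal.tendsto _).comp (tendsto_sum_integral_pow_mul_sin q)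
  have hval := tendsto_nhds_unique hlim
    (((tendsto_sum_integral_pow_mul_sin_zeta hp).const_mul 2).congr fun N => by simp)
  rw [(hasSum_riemannZeta_two_mul_div q).tsum_eq, hval, Finset.range_eq_Ico,
    Finset.sum_eq_sum_Ico_succ_bot (Nat.succ_pos _)]
  have hpi : (π : ℂ) ≠ 0 := by exact_mod_cast Real.pi_ne_zero
  rw [mul_add, mul_add, sub_eq_add_neg _ (ite _ _ _)]
  congr 1
  · rw [neg_add, mul_add, mul_add, sub_eq_add_neg (-(1 / 2) * _)]
    congr 1
    · have hf : (Nat.factorial (q + 1) : ℂ) ≠ 0 := by exact_mod_cast Nat.factorial_ne_zero _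
      simp
      field_simp
      ring
    · rw [mul_neg, mul_neg, Finset.mul_sum, Finset.mul_sum]
      congr 1
      refine Finset.sum_congr (by ext; simp) fun j hj => ?_
      obtain ⟨hj1, hj2⟩ := Finset.mem_Icc.1 hj
      have hf : (Nat.factorial (q + 1 - 2 * j) : ℂ) ≠ 0 := by
        exact_mod_cast Nat.factorial_ne_zero _
      rw [if_neg (by omega)]
      have h2 : (2 : ℂ) ^ q = 2 ^ (q + 1 - 2 * j) * 4 ^ j / 2 := by
        rw [show (4 : ℂ) = 2 ^ 2 by norm_num, ← pow_mul, ← pow_add,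
          show q + 1 - 2 * j + 2 * j = q + 1 by omega, pow_succ]
        ring
      rw [h2, one_div_pow]
      simp only [Nat.succ_eq_add_one]
      field_simp
      ring
  · split_ifs
    · simp only [Nat.succ_eq_add_one]
      field_simp
      ring
    · simp
end

section
/- For all nonnegative integers r and s, H(r,s) = (-4·π^{2r+2s+2}/(2r+2)!) · ∑_{n=0}^{∞} ζ(2n) / ((2n+2r+2)(2n+2r+3)···(2n+2r+2s+3)·2^{2n}). -/
/-- The multiple zeta value `ζ(s₁,…,s_l) = ∑_{1 ≤ k₁ < ⋯ < k_l} ∏ 1/kᵢ^{sᵢ}`. -/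
noncomputable def MZV (s : List ℕ) : ℝ :=
  ∑' f : {f : Fin s.length → ℕ+ // StrictMono f},
    ∏ i : Fin s.length, (1 : ℝ) / ((f.1 i : ℕ) : ℝ) ^ s.get i

/-- The multiple t-value `t(s₁,…,s_l) = ∑_{1 ≤ k₁ < ⋯ < k_l} ∏ 1/(2kᵢ-1)^{sᵢ}`. -/
noncomputable def MTV (s : List ℕ) : ℝ :=
  ∑' f : {f : Fin s.length → ℕ+ // StrictMono f},
    ∏ i : Fin s.length, (1 : ℝ) / ((2 * (f.1 i : ℕ) - 1 : ℕ) : ℝ) ^ s.get i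

open Real MeasureTheory Filter Topology Finset
open scoped Nat ENNReal

/-- The weight `1 / k^a` as an extended nonnegative real. -/
noncomputable def zetaWeight (a k : ℕ) : ℝ≥0∞ := ENNReal.ofReal (1 / (k : ℝ) ^ a)

open Classical in
/-- The truncated multiple zeta value in which all summation indices exceed `m`. -/
noncomputable def mzvAbove (m : ℕ) (s : List ℕ) : ℝ≥0∞ :=
  ∑' f : Fin s.length → ℕ+,
    if StrictMono f ∧ ∀ i, m < (f i : ℕ) then ∏ i, zetaWeight (s.get i) (f i) else 0

lemma MZV_eq_toReal_mzvAbove (s : List ℕ) : MZV s = (mzvAbove 0 s).toReal := by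
  classical
  have h : mzvAbove 0 s = ∑' f : {f : Fin s.length → ℕ+ // StrictMono f},
      ∏ i, zetaWeight (s.get i) (f.1 i) := by
    rw [mzvAbove]
    simp only [PNat.pos, implies_true, and_true]
    refine Eq.trans (tsum_congr fun f => ?_)
      (tsum_subtype {f : Fin s.length → ℕ+ | StrictMono f}
        (fun f => ∏ i, zetaWeight (s.get i) (f i))).symm
    simp [Set.indicator_apply]
  rw [h, ENNReal.tsum_toReal_eq]
  · refine tsum_congr fun f => ?_
    rw [ENNReal.toReal_prod]
    refine prod_congr rfl fun i _ => ?_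
    rw [zetaWeight, ENNReal.toReal_ofReal (by positivity)]
  · exact fun f => ENNReal.prod_ne_top fun i _ => ENNReal.ofReal_ne_top

lemma mzvAbove_nil (m : ℕ) : mzvAbove m [] = 1 := by
  simp [mzvAbove, StrictMono]

lemma strictMono_cons_iff {n : ℕ} {α : Type*} [Preorder α] (k : α) (g : Fin n → α) :
    StrictMono (Fin.cons k g : Fin (n + 1) → α) ↔ StrictMono g ∧ ∀ i, k < g i := by
  constructor
  · intro h
    exact ⟨fun i j hij => by simpa using h (Fin.succ_lt_succ_iff.2 hij),
      fun i => by simpa using h (Fin.succ_pos i)⟩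
  · rintro ⟨hg, hk⟩ i j hij
    refine Fin.cases (fun hij => ?_) (fun i hij => ?_) i hij
    · obtain ⟨j, rfl⟩ := Fin.exists_succ_eq.2 hij.ne'
      simpa using hk j
    · obtain ⟨j, rfl⟩ := Fin.exists_succ_eq.2 ((Fin.succ_pos i).trans hij).ne'
      simpa using hg (Fin.succ_lt_succ_iff.1 hij)

lemma tsum_pnat_above (m : ℕ) (g : ℕ → ℝ≥0∞) :
    ∑' k : ℕ+, (if m < (k : ℕ) then g k else 0) = ∑' l : ℕ, g (m + l + 1) := by
  rw [tsum_pnat_eq_tsum_succ (f := fun k => if m < k then g k else 0),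
    ← ENNReal.summable.sum_add_tsum_nat_add' (k := m)]
  rw [Finset.sum_eq_zero (fun i hi => if_neg (by simpa using hi)), zero_add]
  exact tsum_congr fun l => by rw [if_pos (by omega), add_comm l m]

lemma mzvAbove_cons (m a : ℕ) (s : List ℕ) :
    mzvAbove m (a :: s) = ∑' l : ℕ, zetaWeight a (m + l + 1) * mzvAbove (m + l + 1) s := by
  classical
  rw [← tsum_pnat_above m (fun k => zetaWeight a k * mzvAbove k s)]
  have h : mzvAbove m (a :: s) = ∑' p : ℕ+ × (Fin s.length → ℕ+),
      if StrictMono (Fin.cons p.1 p.2 : Fin (s.length + 1) → ℕ+) ∧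
          ∀ i, m < ((Fin.cons p.1 p.2 : Fin (s.length + 1) → ℕ+) i : ℕ) then
        ∏ i, zetaWeight ((a :: s).get i) ((Fin.cons p.1 p.2 : Fin (s.length + 1) → ℕ+) i) else 0 :=
    ((Fin.consEquiv (fun _ : Fin (s.length + 1) => ℕ+)).tsum_eq _).symm
  rw [h, ENNReal.tsum_prod']
  refine tsum_congr fun k => ?_
  split_ifs with hk
  · rw [mzvAbove, ← ENNReal.tsum_mul_left]
    refine tsum_congr fun g => ?_
    have hiff : (StrictMono (Fin.cons k g : Fin (s.length + 1) → ℕ+) ∧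
        ∀ i, m < ((Fin.cons k g : Fin (s.length + 1) → ℕ+) i : ℕ)) ↔
        (StrictMono g ∧ ∀ i, (k : ℕ) < (g i : ℕ)) := by
      rw [strictMono_cons_iff]
      refine ⟨fun h => ⟨h.1.1, fun i => h.1.2 i⟩, fun h => ⟨⟨h.1, fun i => h.2 i⟩, fun i => ?_⟩⟩
      refine Fin.cases (by simpa using hk) (fun i => ?_) i
      simpa using hk.trans (h.2 i)
    simp only [hiff]
    split_ifs
    · exact Fin.prod_univ_succ (fun i : Fin (s.length + 1) => zetaWeight ((a :: s).get i)
        ((Fin.cons k g : Fin (s.length + 1) → ℕ+) i))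
    · simp
  · refine ENNReal.tsum_eq_zero.2 fun g => if_neg fun h => hk ?_
    simpa using h.2 0

/-- The finite nested sum `∑_{0 < k₁ < ⋯ < k_r < k} ∏ 1 / kᵢ²`. -/
noncomputable def nestedSum : ℕ → ℕ → ℝ
  | 0, _ => 1
  | r + 1, k => ∑ j ∈ range k, nestedSum r j / (j : ℝ) ^ 2

lemma nestedSum_nonneg (r k : ℕ) : 0 ≤ nestedSum r k := by
  induction r generalizing k with
  | zero => exact zero_le_one
  | succ r ih => exact sum_nonneg fun j _ => div_nonneg (ih j) (by positivity)

lemma tsum_nestedSum_succ_mul (r : ℕ) (h : ℕ → ℝ≥0∞) :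
    ∑' k : ℕ, ENNReal.ofReal (nestedSum (r + 1) (k + 1)) * h (k + 1)
      = ∑' j : ℕ, ENNReal.ofReal (nestedSum r (j + 1)) *
          (zetaWeight 2 (j + 1) * ∑' l : ℕ, h (j + 1 + l + 1)) := by
  have hk : ∀ k : ℕ, ENNReal.ofReal (nestedSum (r + 1) (k + 1)) * h (k + 1) = ∑' j : ℕ,
      if j + 1 < k + 1 then ENNReal.ofReal (nestedSum r (j + 1)) * zetaWeight 2 (j + 1) * h (k + 1)
      else 0 := fun k => by
    have h2 : nestedSum (r + 1) (k + 1)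
        = ∑ j ∈ range k, nestedSum r (j + 1) / ((j + 1 : ℕ) : ℝ) ^ 2 := by
      rw [nestedSum, sum_range_succ']
      simp
    rw [h2, ENNReal.ofReal_sum_of_nonneg
      (fun j _ => div_nonneg (nestedSum_nonneg _ _) (by positivity)), sum_mul,
      tsum_eq_sum (s := range k) (fun j hj => if_neg (by simpa using hj))]
    refine sum_congr rfl fun j hj => ?_
    rw [if_pos (by simpa using hj), zetaWeight, ← ENNReal.ofReal_mul (nestedSum_nonneg _ _),
      mul_one_div]
  simp only [hk]
  rw [ENNReal.tsum_comm]
  refine tsum_congr fun j => ?_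
  rw [← tsum_pnat_above (j + 1) h, ← mul_assoc, ← ENNReal.tsum_mul_left,
    tsum_pnat_eq_tsum_succ (f := fun k => ENNReal.ofReal (nestedSum r (j + 1)) *
      zetaWeight 2 (j + 1) * if j + 1 < k then h k else 0)]
  exact tsum_congr fun k => by rw [mul_ite, mul_zero]

lemma mzvAbove_replicate_append (r a : ℕ) (s : List ℕ) :
    mzvAbove 0 (List.replicate r 2 ++ a :: s)
      = ∑' k : ℕ, ENNReal.ofReal (nestedSum r (k + 1)) *
          (zetaWeight a (k + 1) * mzvAbove (k + 1) s) := by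
  induction r generalizing a s with
  | zero => simp [mzvAbove_cons, nestedSum]
  | succ r ih =>
    have hl : List.replicate (r + 1) 2 ++ a :: s = List.replicate r 2 ++ 2 :: a :: s := by
      rw [List.replicate_succ', List.append_assoc, List.singleton_append]
    rw [hl, ih, tsum_nestedSum_succ_mul r (fun k => zetaWeight a k * mzvAbove k s)]
    exact tsum_congr fun j => by rw [mzvAbove_cons]

/-- The Wallis ratio `∏_{i < k} (2i+1)/(2i+2) = C(2k,k) / 4^k`. -/
noncomputable def wallisRatio (k : ℕ) : ℝ := ∏ i ∈ range k, (2 * i + 1 : ℝ) / (2 * i + 2)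

lemma wallisRatio_succ (k : ℕ) :
    wallisRatio (k + 1) = wallisRatio k * ((2 * k + 1) / (2 * k + 2)) :=
  prod_range_succ _ _

lemma wallisRatio_pos (k : ℕ) : 0 < wallisRatio k :=
  prod_pos fun _ _ => by positivity

lemma inv_wallisRatio_le (k : ℕ) : (wallisRatio k)⁻¹ ≤ 2 * k + 1 := by
  induction k with
  | zero => simp [wallisRatio]
  | succ k ih =>
    rw [wallisRatio_succ, mul_inv, inv_div]
    push_cast
    calc (wallisRatio k)⁻¹ * ((2 * k + 2) / (2 * k + 1))
        ≤ (2 * k + 1) * ((2 * k + 2) / (2 * k + 1)) := by gcongr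
      _ = 2 * k + 2 := by field_simp
      _ ≤ 2 * (k + 1) + 1 := by linarith

/-- The divided power `(π/2 - x)^n / n!`. -/
noncomputable def coPow (n : ℕ) (x : ℝ) : ℝ := (π / 2 - x) ^ n / n !

lemma hasDerivAt_coPow_succ (n : ℕ) (x : ℝ) : HasDerivAt (coPow (n + 1)) (-coPow n x) x := by
  have h := (((hasDerivAt_id x).const_sub (π / 2)).pow (n + 1)).div_const ((n + 1)! : ℝ)
  refine h.congr_deriv ?_
  simp only [coPow, Nat.factorial_succ, id]
  push_cast
  field_simp

@[fun_prop]
lemma continuous_coPow (n : ℕ) : Continuous (coPow n) := by unfold coPow; fun_prop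

@[simp] lemma coPow_zero (x : ℝ) : coPow 0 x = 1 := by simp [coPow]

@[simp] lemma coPow_succ_pi_div_two (n : ℕ) : coPow (n + 1) (π / 2) = 0 := by simp [coPow]

lemma coPow_nonneg (n : ℕ) {x : ℝ} (hx : x ≤ π / 2) : 0 ≤ coPow n x :=
  div_nonneg (pow_nonneg (by linarith) _) (by positivity)

lemma hasDerivAt_sin_pow (n : ℕ) (x : ℝ) :
    HasDerivAt (fun x => sin x ^ (n + 1)) ((n + 1) * sin x ^ n * cos x) x := by
  simpa [Pi.pow_def] using (hasDerivAt_sin x).pow (n + 1)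

lemma hasDerivAt_sin_pow_mul_cos (n : ℕ) (x : ℝ) :
    HasDerivAt (fun x => sin x ^ (n + 1) * cos x)
      ((n + 1) * sin x ^ n - (n + 2) * sin x ^ (n + 2)) x := by
  refine ((hasDerivAt_sin_pow n x).mul (hasDerivAt_cos x)).congr_deriv ?_
  have := cos_sq' x
  linear_combination ((n : ℝ) + 1) * sin x ^ n * this

/-- The integral `∫_0^{π/2} sin^{2k} x (π/2 - x)^{2s}/(2s)! dx`. -/
noncomputable def sinMoment (k s : ℕ) : ℝ :=
  ∫ x in 0..π / 2, sin x ^ (2 * k) * coPow (2 * s) x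

lemma sinMoment_zero_right (k : ℕ) : sinMoment k 0 = π / 2 * wallisRatio k := by
  induction k with
  | zero => simp [sinMoment, wallisRatio]
  | succ k ih =>
    have h : ∫ x in 0..π / 2, ((2 * k : ℕ) + 1 : ℝ) * sin x ^ (2 * k)
        - ((2 * k : ℕ) + 2 : ℝ) * sin x ^ (2 * k + 2) = 0 := by
      rw [intervalIntegral.integral_eq_sub_of_hasDerivAt
        (fun x _ => hasDerivAt_sin_pow_mul_cos (2 * k) x)
        (Continuous.intervalIntegrable (by fun_prop) _ _)]
      simp
    rw [intervalIntegral.integral_sub (Continuous.intervalIntegrable (by fun_prop) _ _)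
      (Continuous.intervalIntegrable (by fun_prop) _ _),
      intervalIntegral.integral_const_mul, intervalIntegral.integral_const_mul] at h
    simp only [sinMoment, mul_zero, coPow_zero, mul_one] at ih ⊢
    rw [ih] at h
    rw [wallisRatio_succ, show 2 * (k + 1) = 2 * k + 2 by ring]
    push_cast at h
    field_simp
    linarith

lemma sinMoment_recurrence (k s : ℕ) :
    (2 * k + 2) * (2 * k + 1) * sinMoment k (s + 1) - (2 * k + 2) ^ 2 * sinMoment (k + 1) (s + 1)
      = sinMoment (k + 1) s := by
  have h : ∫ x in 0..π / 2, ((2 * k + 2) * (2 * k + 1) * (sin x ^ (2 * k) * coPow (2 * (s + 1)) x)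
      - (2 * k + 2) ^ 2 * (sin x ^ (2 * (k + 1)) * coPow (2 * (s + 1)) x)
      - sin x ^ (2 * (k + 1)) * coPow (2 * s) x : ℝ) = 0 := by
    rw [intervalIntegral.integral_eq_sub_of_hasDerivAt
      (f := fun x => (2 * k + 2) * (sin x ^ (2 * k + 1) * cos x) * coPow (2 * s + 2) x
        + sin x ^ (2 * k + 2) * coPow (2 * s + 1) x) _
        (Continuous.intervalIntegrable (by fun_prop) _ _)]
    · simp
    · intro x _
      refine ((((hasDerivAt_sin_pow_mul_cos (2 * k) x).const_mul (2 * k + 2 : ℝ)).mul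
        (hasDerivAt_coPow_succ (2 * s + 1) x)).add ((hasDerivAt_sin_pow (2 * k + 1) x).mul
        (hasDerivAt_coPow_succ (2 * s) x))).congr_deriv ?_
      simp only [mul_add, mul_one]
      push_cast
      ring
  rw [intervalIntegral.integral_sub, intervalIntegral.integral_sub,
    intervalIntegral.integral_const_mul, intervalIntegral.integral_const_mul, sub_eq_zero] at h
  · exact h
  all_goals exact Continuous.intervalIntegrable (by fun_prop) _ _

lemma integral_sin_pow_mul_cos_mul_coPow (k s : ℕ) :
    ∫ x in 0..π / 2, sin x ^ (2 * k + 1) * cos x * coPow (2 * s + 1) x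
      = sinMoment (k + 1) s / (2 * k + 2) := by
  have h : ∫ x in 0..π / 2, ((2 * k + 2) * (sin x ^ (2 * k + 1) * cos x * coPow (2 * s + 1) x)
      - sin x ^ (2 * (k + 1)) * coPow (2 * s) x : ℝ) = 0 := by
    rw [intervalIntegral.integral_eq_sub_of_hasDerivAt
      (f := fun x => sin x ^ (2 * k + 2) * coPow (2 * s + 1) x) _
        (Continuous.intervalIntegrable (by fun_prop) _ _)]
    · simp
    · intro x _
      refine ((hasDerivAt_sin_pow (2 * k + 1) x).mul
        (hasDerivAt_coPow_succ (2 * s) x)).congr_deriv ?_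
      simp only [mul_add, mul_one]
      push_cast
      ring
  rw [intervalIntegral.integral_sub, intervalIntegral.integral_const_mul, sub_eq_zero] at h
  · rw [eq_div_iff (by positivity), mul_comm]
    exact h
  all_goals exact Continuous.intervalIntegrable (by fun_prop) _ _

lemma sinMoment_nonneg (k s : ℕ) : 0 ≤ sinMoment k s :=
  intervalIntegral.integral_nonneg (by positivity) fun x hx =>
    mul_nonneg (by rw [pow_mul]; positivity) (coPow_nonneg _ hx.2)

lemma coPow_le_cos_sq (s : ℕ) {x : ℝ} (h0 : 0 ≤ x) (h1 : x ≤ π / 2) :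
    coPow (2 * (s + 1)) x ≤ (π / 2) ^ (2 * s + 2) * cos x ^ 2 := by
  have hc := mul_le_sin (x := π / 2 - x) (by linarith) (by linarith)
  rw [sin_pi_div_two_sub] at hc
  have h2 : π / 2 - x ≤ π / 2 * cos x := by
    have := mul_le_mul_of_nonneg_left hc (by positivity : 0 ≤ π / 2)
    rwa [← mul_assoc, show π / 2 * (2 / π) = 1 by field_simp, one_mul] at this
  have hcos : 0 ≤ cos x := cos_nonneg_of_neg_pi_div_two_le_of_le (by linarith) h1
  calc coPow (2 * (s + 1)) x ≤ (π / 2 - x) ^ (2 * (s + 1)) :=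
        div_le_self (pow_nonneg (by linarith) _) 
          (by exact_mod_cast Nat.one_le_iff_ne_zero.2 (Nat.factorial_ne_zero _))
    _ ≤ (π / 2 * cos x) ^ (2 * (s + 1)) := by gcongr
    _ = (π / 2) ^ (2 * s + 2) * (cos x ^ 2 * cos x ^ (2 * s)) := by ring
    _ ≤ (π / 2) ^ (2 * s + 2) * (cos x ^ 2 * 1) := by
        gcongr
        exact pow_le_one₀ hcos (cos_le_one x)
    _ = _ := by ring

lemma sinMoment_succ_le (k s : ℕ) :
    sinMoment k (s + 1) ≤ (π / 2) ^ (2 * s + 3) * wallisRatio k / (2 * k + 2) := by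
  have h : sinMoment k (s + 1) ≤
      ∫ x in 0..π / 2, (π / 2) ^ (2 * s + 2) * (sin x ^ (2 * k) - sin x ^ (2 * (k + 1))) := by
    refine intervalIntegral.integral_mono_on (by positivity)
      (Continuous.intervalIntegrable (by fun_prop) _ _)
      (Continuous.intervalIntegrable (by fun_prop) _ _) fun x hx => ?_
    calc sin x ^ (2 * k) * coPow (2 * (s + 1)) x
        ≤ sin x ^ (2 * k) * ((π / 2) ^ (2 * s + 2) * cos x ^ 2) :=
          mul_le_mul_of_nonneg_left (coPow_le_cos_sq s hx.1 hx.2) (by rw [pow_mul]; positivity)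
      _ = _ := by rw [cos_sq']; ring
  have h0 := sinMoment_zero_right k
  have h1 := sinMoment_zero_right (k + 1)
  simp only [sinMoment, mul_zero, coPow_zero, mul_one] at h0 h1
  rw [intervalIntegral.integral_const_mul, intervalIntegral.integral_sub
    (Continuous.intervalIntegrable (by fun_prop) _ _)
    (Continuous.intervalIntegrable (by fun_prop) _ _), h0, h1, wallisRatio_succ] at h
  refine h.trans (le_of_eq ?_)
  field_simp
  ring

/-- The normalised moment, which is `(π/2) 4^{-s}` times a tail of `ζ({2}^s)`. -/
noncomputable def sinMomentRatio (k s : ℕ) : ℝ := sinMoment k s / wallisRatio k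

lemma sinMomentRatio_nonneg (k s : ℕ) : 0 ≤ sinMomentRatio k s :=
  div_nonneg (sinMoment_nonneg k s) (wallisRatio_pos k).le

lemma sinMomentRatio_zero_right (k : ℕ) : sinMomentRatio k 0 = π / 2 := by
  rw [sinMomentRatio, sinMoment_zero_right, mul_div_cancel_right₀ _ (wallisRatio_pos k).ne']

lemma sinMomentRatio_sub (k s : ℕ) :
    sinMomentRatio k (s + 1) - sinMomentRatio (k + 1) (s + 1)
      = sinMomentRatio (k + 1) s / (2 * k + 2) ^ 2 := by
  have h := sinMoment_recurrence k s
  have hw := (wallisRatio_pos k).ne'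
  simp only [sinMomentRatio, wallisRatio_succ, ← h]
  field_simp

lemma tendsto_sinMomentRatio (s : ℕ) :
    Tendsto (fun k => sinMomentRatio k (s + 1)) atTop (𝓝 0) := by
  have hlim : Tendsto (fun k : ℕ => (π / 2) ^ (2 * s + 3) * (1 / ((k : ℝ) + 1))) atTop (𝓝 0) := by
    simpa using (tendsto_one_div_add_atTop_nhds_zero_nat (𝕜 := ℝ)).const_mul _
  refine squeeze_zero (fun k => sinMomentRatio_nonneg k _) (fun k => ?_) hlim
  have hw := wallisRatio_pos k
  rw [sinMomentRatio, div_le_iff₀ hw]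
  refine (sinMoment_succ_le k s).trans ?_
  rw [mul_one_div, div_mul_eq_mul_div]
  gcongr <;> linarith

lemma hasSum_sinMomentRatio (k s : ℕ) :
    HasSum (fun l : ℕ => sinMomentRatio (k + l + 1) s / (2 * (k + l) + 2 : ℝ) ^ 2)
      (sinMomentRatio k (s + 1)) := by
  rw [hasSum_iff_tendsto_nat_of_nonneg
    (fun l => div_nonneg (sinMomentRatio_nonneg _ _) (by positivity))]
  have h : ∀ n, ∑ l ∈ range n, sinMomentRatio (k + l + 1) s / (2 * (k + l) + 2 : ℝ) ^ 2
      = sinMomentRatio k (s + 1) - sinMomentRatio (k + n) (s + 1) := fun n => by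
    refine Eq.trans ?_ (Finset.sum_range_sub' (fun l => sinMomentRatio (k + l) (s + 1)) n)
    refine Finset.sum_congr rfl fun l _ => ?_
    have := sinMomentRatio_sub (k + l) s
    push_cast at this
    rw [← this, add_assoc]
  simp only [h]
  simpa using ((tendsto_sinMomentRatio s).comp (tendsto_add_atTop_nat k)).const_sub
    (sinMomentRatio k (s + 1)) |>.congr fun n => by simp [add_comm]

lemma hasDerivAt_dividedPow (n : ℕ) (x : ℝ) :
    HasDerivAt (fun x : ℝ => x ^ (n + 1) / (n + 1)!) (x ^ n / n !) x := by
  refine ((hasDerivAt_pow (n + 1) x).div_const _).congr_deriv ?_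
  simp only [Nat.factorial_succ, Nat.add_sub_cancel]
  push_cast
  field_simp

/-- The coefficient of `sin^{2k+2} x` in the expansion of `x^{2r+2}/(2r+2)!`. -/
noncomputable def arcsinCoeff (r k : ℕ) : ℝ :=
  nestedSum r (k + 1) / (4 ^ (r + 1) * ((k : ℝ) + 1) ^ 2 * wallisRatio (k + 1))

lemma arcsinCoeff_nonneg (r k : ℕ) : 0 ≤ arcsinCoeff r k :=
  div_nonneg (nestedSum_nonneg _ _) (mul_nonneg (by positivity) (wallisRatio_pos _).le)

/-- The remainder in the expansion of `x^{2r+2}/(2r+2)!` in powers of `sin x`. -/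
noncomputable def arcsinRemainder (r N : ℕ) (x : ℝ) : ℝ :=
  x ^ (2 * r + 2) / (2 * r + 2)! - ∑ k ∈ range N, arcsinCoeff r k * sin x ^ (2 * k + 2)

/-- The first derivative of `arcsinRemainder`. -/
noncomputable def arcsinRemainderDeriv (r N : ℕ) (x : ℝ) : ℝ :=
  x ^ (2 * r + 1) / (2 * r + 1)! -
    ∑ k ∈ range N, arcsinCoeff r k * ((2 * k + 2) * (sin x ^ (2 * k + 1) * cos x))

/-- The second derivative of `arcsinRemainder`. -/
noncomputable def arcsinRemainderDerivTwo (r N : ℕ) (x : ℝ) : ℝ :=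
  x ^ (2 * r) / (2 * r)! - ∑ k ∈ range N, arcsinCoeff r k *
    ((2 * k + 2) * ((2 * k + 1) * sin x ^ (2 * k) - (2 * k + 2) * sin x ^ (2 * k + 2)))

lemma hasDerivAt_arcsinRemainder (r N : ℕ) (x : ℝ) :
    HasDerivAt (arcsinRemainder r N) (arcsinRemainderDeriv r N x) x := by
  refine (hasDerivAt_dividedPow (2 * r + 1) x).sub (HasDerivAt.fun_sum fun k _ => ?_)
  refine ((hasDerivAt_sin_pow (2 * k + 1) x).const_mul _).congr_deriv ?_
  push_cast
  ring

lemma hasDerivAt_arcsinRemainderDeriv (r N : ℕ) (x : ℝ) :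
    HasDerivAt (arcsinRemainderDeriv r N) (arcsinRemainderDerivTwo r N x) x := by
  refine (hasDerivAt_dividedPow (2 * r) x).sub (HasDerivAt.fun_sum fun k _ => ?_)
  refine (((hasDerivAt_sin_pow_mul_cos (2 * k) x).const_mul _).const_mul _).congr_deriv ?_
  push_cast
  ring

lemma arcsinRemainderDerivTwo_zero (N : ℕ) (x : ℝ) :
    arcsinRemainderDerivTwo 0 N x = sin x ^ (2 * N) / wallisRatio N := by
  simp only [arcsinRemainderDerivTwo, mul_zero, pow_zero, Nat.factorial_zero, Nat.cast_one, div_one]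
  induction N with
  | zero => simp [wallisRatio]
  | succ N ih =>
    have hw := (wallisRatio_pos N).ne'
    rw [sum_range_succ, ← sub_sub, ih, arcsinCoeff, wallisRatio_succ]
    simp only [nestedSum]
    field_simp
    ring

lemma arcsinRemainderDerivTwo_succ (r N : ℕ) (x : ℝ) :
    arcsinRemainderDerivTwo (r + 1) N x = arcsinRemainder r N x +
      nestedSum (r + 1) (N + 1) / (4 ^ (r + 1) * wallisRatio N) * sin x ^ (2 * N) := by
  simp only [arcsinRemainderDerivTwo, arcsinRemainder, mul_add, mul_one]
  induction N with
  | zero => simp [nestedSum]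
  | succ N ih =>
    have hw := (wallisRatio_pos N).ne'
    have he : nestedSum (r + 1) (N + 1 + 1)
        = nestedSum (r + 1) (N + 1) + nestedSum r (N + 1) / ((N : ℝ) + 1) ^ 2 := by
      rw [nestedSum, sum_range_succ]
      push_cast
      rfl
    rw [sum_range_succ, sum_range_succ, ← sub_sub, ih, he, arcsinCoeff, arcsinCoeff,
      wallisRatio_succ]
    field_simp
    ring

lemma bounds_of_second_deriv {f f' f'' : ℝ → ℝ} (hf : ∀ x, HasDerivAt f (f' x) x)
    (hf' : ∀ x, HasDerivAt f' (f'' x) x) (h0 : f 0 = 0) (h0' : f' 0 = 0) {x K : ℝ} (hx : 0 ≤ x)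
    (hbound : ∀ t ∈ Set.Icc 0 x, 0 ≤ f'' t ∧ f'' t ≤ K) : 0 ≤ f x ∧ f x ≤ K * x ^ 2 := by
  rcases hx.eq_or_lt with rfl | hx
  · simp [h0]
  obtain ⟨c, hc, hfc⟩ := exists_hasDerivAt_eq_slope f f' hx
    (fun y _ => (hf y).continuousAt.continuousWithinAt) fun y _ => hf y
  obtain ⟨d, hd, hfd⟩ := exists_hasDerivAt_eq_slope f' f'' hc.1
    (fun y _ => (hf' y).continuousAt.continuousWithinAt) fun y _ => hf' y
  have hc0 := hc.1
  have h1 : f x = f'' d * c * x := by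
    rw [h0, sub_zero, sub_zero] at hfc
    rw [h0', sub_zero, sub_zero] at hfd
    rw [hfd, div_mul_cancel₀ _ hc0.ne', hfc, div_mul_cancel₀ _ hx.ne']
  obtain ⟨hb0, hb1⟩ := hbound d ⟨hd.1.le, (hd.2.trans hc.2).le⟩
  rw [h1]
  refine ⟨by positivity, ?_⟩
  calc f'' d * c * x ≤ K * x * x := by
        have := hc.2.le
        have hK := hb0.trans hb1
        gcongr
    _ = K * x ^ 2 := by ring

lemma nestedSum_le_pow (r k : ℕ) : nestedSum r k ≤ (k : ℝ) ^ r := by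
  induction r generalizing k with
  | zero => simp [nestedSum]
  | succ r ih =>
    calc nestedSum (r + 1) k ≤ ∑ j ∈ range k, (k : ℝ) ^ r := by
          refine sum_le_sum fun j hj => ?_
          rcases Nat.eq_zero_or_pos j with rfl | hj0
          · simp
          · have h1 : (1 : ℝ) ≤ j := by exact_mod_cast hj0
            refine (div_le_self (nestedSum_nonneg _ _) (one_le_pow₀ h1)).trans ((ih j).trans ?_)
            have := (mem_range.1 hj).le
            gcongr
      _ = (k : ℝ) ^ (r + 1) := by simp [pow_succ, mul_comm]

lemma arcsinRemainder_bounds (r : ℕ) : ∃ C : ℝ, 0 ≤ C ∧ ∀ (N : ℕ) (x : ℝ), 0 ≤ x → x ≤ π / 2 →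
    0 ≤ arcsinRemainder r N x ∧
      arcsinRemainder r N x ≤ C * (2 * N + 2) ^ (r + 1) * sin x ^ (2 * N) := by
  have key : ∀ (r N : ℕ) (K x : ℝ), 0 ≤ K → 0 ≤ x → x ≤ π / 2 →
      (∀ t, 0 ≤ t → t ≤ π / 2 → 0 ≤ arcsinRemainderDerivTwo r N t ∧
        arcsinRemainderDerivTwo r N t ≤ K * sin t ^ (2 * N)) →
      0 ≤ arcsinRemainder r N x ∧ arcsinRemainder r N x ≤ 4 * K * sin x ^ (2 * N) := by
    intro r N K x hK hx0 hx1 h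
    have hs : 0 ≤ sin x := sin_nonneg_of_nonneg_of_le_pi hx0 (by linarith [pi_pos])
    obtain ⟨h1, h2⟩ := bounds_of_second_deriv (hasDerivAt_arcsinRemainder r N)
      (hasDerivAt_arcsinRemainderDeriv r N) (by simp [arcsinRemainder])
      (by simp [arcsinRemainderDeriv]) (K := K * sin x ^ (2 * N)) hx0 fun t ht => by
        obtain ⟨ha, hb⟩ := h t ht.1 (ht.2.trans hx1)
        refine ⟨ha, hb.trans ?_⟩
        have hst : 0 ≤ sin t :=
          sin_nonneg_of_nonneg_of_le_pi ht.1 (by linarith [pi_pos, ht.2])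
        have hle : sin t ≤ sin x :=
          sin_le_sin_of_le_of_le_pi_div_two (by linarith [pi_pos, ht.1]) hx1 ht.2
        gcongr
    refine ⟨h1, h2.trans ?_⟩
    have hx2 : x ^ 2 ≤ 4 := by nlinarith [pi_le_four]
    calc K * sin x ^ (2 * N) * x ^ 2 ≤ K * sin x ^ (2 * N) * 4 := by gcongr
      _ = _ := by ring
  induction r with
  | zero =>
    refine ⟨4, by norm_num, fun N x hx0 hx1 => ?_⟩
    simp only [zero_add, pow_one]
    refine key 0 N (2 * N + 2) x (by positivity) hx0 hx1 fun t ht0 ht1 => ?_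
    have hw := wallisRatio_pos N
    have hs : 0 ≤ sin t := sin_nonneg_of_nonneg_of_le_pi ht0 (by linarith [pi_pos])
    rw [arcsinRemainderDerivTwo_zero]
    refine ⟨by positivity, ?_⟩
    rw [div_eq_inv_mul]
    have := inv_wallisRatio_le N
    gcongr
    linarith
  | succ r ih =>
    obtain ⟨C, hC, ih⟩ := ih
    refine ⟨4 * (C + 1), by positivity, fun N x hx0 hx1 => ?_⟩
    rw [mul_assoc 4]
    refine key (r + 1) N ((C + 1) * (2 * N + 2) ^ (r + 1 + 1)) x (by positivity) hx0 hx1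
      fun t ht0 ht1 => ?_
    have hw := wallisRatio_pos N
    have hs : 0 ≤ sin t := sin_nonneg_of_nonneg_of_le_pi ht0 (by linarith [pi_pos])
    have hn := nestedSum_nonneg (r + 1) (N + 1)
    obtain ⟨h1, h2⟩ := ih N t ht0 ht1
    rw [arcsinRemainderDerivTwo_succ]
    refine ⟨by positivity, ?_⟩
    have h3 : nestedSum (r + 1) (N + 1) / (4 ^ (r + 1) * wallisRatio N)
        ≤ (2 * N + 2) ^ (r + 1 + 1) := by
      have h4 : nestedSum (r + 1) (N + 1) / 4 ^ (r + 1) ≤ (2 * N + 2) ^ (r + 1) := by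
        refine (div_le_self hn (one_le_pow₀ (by norm_num))).trans ((nestedSum_le_pow _ _).trans ?_)
        push_cast
        gcongr <;> linarith [(Nat.cast_nonneg N : (0 : ℝ) ≤ N)]
      rw [← div_div, div_eq_mul_inv _ (wallisRatio N), pow_succ _ (r + 1)]
      have := inv_wallisRatio_le N
      gcongr
      linarith
    have h5 : C * (2 * N + 2 : ℝ) ^ (r + 1) ≤ C * (2 * N + 2) ^ (r + 1 + 1) := by
      gcongr
      · linarith [(Nat.cast_nonneg N : (0 : ℝ) ≤ N)]
      · omega
    calc _ ≤ C * (2 * N + 2 : ℝ) ^ (r + 1 + 1) * sin t ^ (2 * N)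
          + (2 * N + 2) ^ (r + 1 + 1) * sin t ^ (2 * N) := by
          refine add_le_add (h2.trans ?_) ?_ <;> gcongr
      _ = _ := by ring

lemma tendsto_arcsinRemainder (r : ℕ) {x : ℝ} (h0 : 0 ≤ x) (h1 : x < π / 2) :
    Tendsto (fun N => arcsinRemainder r N x) atTop (𝓝 0) := by
  obtain ⟨C, hC, hb⟩ := arcsinRemainder_bounds r
  have hs0 : 0 ≤ sin x := sin_nonneg_of_nonneg_of_le_pi h0 (by linarith [pi_pos])
  have hs : sin x < 1 := by
    rw [← sin_pi_div_two]
    exact sin_lt_sin_of_lt_of_le_pi_div_two (by linarith [pi_pos]) le_rfl h1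
  have hlim : Tendsto (fun N : ℕ => C * 4 ^ (r + 1) * ((N : ℝ) ^ (r + 1) * (sin x ^ 2) ^ N))
      atTop (𝓝 0) := by
    simpa using (tendsto_pow_const_mul_const_pow_of_abs_lt_one (r + 1)
      (by rw [abs_of_nonneg (by positivity)]; nlinarith : |sin x ^ 2| < 1)).const_mul _
  refine squeeze_zero' (Eventually.of_forall fun N => (hb N x h0 h1.le).1) ?_ hlim
  filter_upwards [eventually_ge_atTop 1] with N hN
  have hN' : (1 : ℝ) ≤ N := by exact_mod_cast hN
  refine (hb N x h0 h1.le).2.trans ?_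
  calc C * (2 * N + 2) ^ (r + 1) * sin x ^ (2 * N)
      ≤ C * (4 * N) ^ (r + 1) * sin x ^ (2 * N) := by gcongr; linarith
    _ = _ := by rw [mul_pow, pow_mul]; ring

lemma integral_arcsinPartial (r s N : ℕ) :
    ∫ x in 0..π / 2, (∑ k ∈ range N, arcsinCoeff r k * sin x ^ (2 * k + 2)) *
        (coPow (2 * s + 1) x * (cos x / sin x))
      = ∑ k ∈ range N, nestedSum r (k + 1) * sinMomentRatio (k + 1) s /
          (2 * 4 ^ (r + 1) * ((k : ℝ) + 1) ^ 3) := by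
  have h : ∀ x, (∑ k ∈ range N, arcsinCoeff r k * sin x ^ (2 * k + 2)) *
        (coPow (2 * s + 1) x * (cos x / sin x)) = ∑ k ∈ range N,
      arcsinCoeff r k * (sin x ^ (2 * k + 1) * cos x * coPow (2 * s + 1) x) := fun x => by
    rw [sum_mul]
    refine sum_congr rfl fun k _ => ?_
    by_cases hx : sin x = 0
    · simp [hx]
    · field_simp
      ring
  simp only [h]
  rw [intervalIntegral.integral_finsetSum
    fun k _ => Continuous.intervalIntegrable (by fun_prop) _ _]
  refine sum_congr rfl fun k _ => ?_
  have hw := (wallisRatio_pos (k + 1)).ne'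
  rw [intervalIntegral.integral_const_mul, integral_sin_pow_mul_cos_mul_coPow, arcsinCoeff,
    sinMomentRatio]
  field_simp

lemma hasSum_nestedSum_mul_sinMomentRatio (r s : ℕ) :
    HasSum (fun k : ℕ => nestedSum r (k + 1) * sinMomentRatio (k + 1) s /
        (2 * 4 ^ (r + 1) * ((k : ℝ) + 1) ^ 3))
      (∫ x in 0..π / 2, x ^ (2 * r + 2) / (2 * r + 2)! *
        (coPow (2 * s + 1) x * (cos x / sin x))) := by
  rw [hasSum_iff_tendsto_nat_of_nonneg (fun k => div_nonneg
    (mul_nonneg (nestedSum_nonneg _ _) (sinMomentRatio_nonneg _ _)) (by positivity))]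
  simp only [← integral_arcsinPartial]
  obtain ⟨C, hC, hb⟩ := arcsinRemainder_bounds r
  refine intervalIntegral.tendsto_integral_filter_of_dominated_convergence
    (fun _ => (π / 2) ^ (2 * r + 2) * (π / 2) ^ (2 * s + 1)) ?_ ?_ intervalIntegrable_const ?_
  · refine Eventually.of_forall fun N => Measurable.aestronglyMeasurable ?_
    have := (continuous_coPow (2 * s + 1)).measurable
    fun_prop
  · refine Eventually.of_forall fun N => ae_of_all _ fun x hx => ?_
    rw [Set.uIoc_of_le (by positivity)] at hx
    have hx0 := hx.1
    have hsin : 0 < sin x := sin_pos_of_pos_of_lt_pi hx.1 (by linarith [pi_pos, hx.2])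
    have hcos : 0 ≤ cos x :=
      cos_nonneg_of_neg_pi_div_two_le_of_le (by linarith [pi_pos]) hx.2
    have hco := coPow_nonneg (2 * s + 1) hx.2
    have hS0 : 0 ≤ ∑ k ∈ range N, arcsinCoeff r k * sin x ^ (2 * k + 2) :=
      sum_nonneg fun k _ => mul_nonneg (arcsinCoeff_nonneg _ _) (by positivity)
    have hS1 : ∑ k ∈ range N, arcsinCoeff r k * sin x ^ (2 * k + 2)
        ≤ x ^ (2 * r + 2) := by
      have h := (hb N x hx0.le hx.2).1
      rw [arcsinRemainder, sub_nonneg] at h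
      refine h.trans (div_le_self (by positivity) ?_)
      exact_mod_cast Nat.one_le_iff_ne_zero.2 (Nat.factorial_ne_zero _)
    have hco1 : coPow (2 * s + 1) x ≤ (π / 2) ^ (2 * s + 1) := by
      refine (div_le_self (pow_nonneg (by linarith [hx.2]) _) ?_).trans ?_
      · exact_mod_cast Nat.one_le_iff_ne_zero.2 (Nat.factorial_ne_zero _)
      · have := hx.2
        gcongr
        linarith
    have hcot : x * (cos x / sin x) ≤ π / 2 := by
      have h2 := mul_le_sin hx0.le hx.2
      rw [mul_div_assoc', div_le_iff₀ hsin]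
      calc x * cos x ≤ x * 1 := by gcongr; exact cos_le_one x
        _ = π / 2 * (2 / π * x) := by field_simp
        _ ≤ π / 2 * sin x := by gcongr
    rw [Real.norm_of_nonneg (by positivity)]
    calc _ ≤ x ^ (2 * r + 2) * ((π / 2) ^ (2 * s + 1) * (cos x / sin x)) := by gcongr
      _ = x ^ (2 * r + 1) * (x * (cos x / sin x)) * (π / 2) ^ (2 * s + 1) := by ring
      _ ≤ (π / 2) ^ (2 * r + 1) * (π / 2) * (π / 2) ^ (2 * s + 1) := by
        have := hx.2
        gcongr
      _ = _ := by ring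
  · have hne : ∀ᵐ x : ℝ, x ≠ π / 2 := by simp [ae_iff]
    filter_upwards [hne] with x hxne hx
    rw [Set.uIoc_of_le (by positivity)] at hx
    have h := (tendsto_arcsinRemainder r hx.1.le (lt_of_le_of_ne hx.2 hxne)).const_sub
      (x ^ (2 * r + 2) / (2 * r + 2)!)
    simp only [arcsinRemainder, sub_sub_cancel, sub_zero] at h
    exact h.mul_const _

lemma mzvAbove_replicate_two (m s : ℕ) :
    mzvAbove m (List.replicate s 2) = ENNReal.ofReal (4 ^ s * (2 / π) * sinMomentRatio m s) := by
  induction s generalizing m with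
  | zero =>
    rw [List.replicate_zero, mzvAbove_nil, sinMomentRatio_zero_right,
      show 4 ^ 0 * (2 / π) * (π / 2) = 1 by field_simp, ENNReal.ofReal_one]
  | succ s ih =>
    have h := (hasSum_sinMomentRatio m s).mul_left (4 ^ (s + 1) * (2 / π))
    rw [List.replicate_succ, mzvAbove_cons, ← h.tsum_eq, ENNReal.ofReal_tsum_of_nonneg
      (fun l => mul_nonneg (by positivity) (div_nonneg (sinMomentRatio_nonneg _ _) (by positivity)))
      h.summable]
    refine tsum_congr fun l => ?_
    rw [ih, zetaWeight, ← ENNReal.ofReal_mul (by positivity)]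
    congr 1
    push_cast
    field_simp
    ring

lemma MZV_replicate_two_three (r s : ℕ) :
    MZV (List.replicate r 2 ++ 3 :: List.replicate s 2) = 4 ^ (r + s + 2) / π *
      ∫ x in 0..π / 2, x ^ (2 * r + 2) / (2 * r + 2)! *
        (coPow (2 * s + 1) x * (cos x / sin x)) := by
  have h := (hasSum_nestedSum_mul_sinMomentRatio r s).mul_left (4 ^ (r + s + 2) / π)
  have hnn : ∀ k : ℕ, 0 ≤ 4 ^ (r + s + 2) / π * (nestedSum r (k + 1) * sinMomentRatio (k + 1) s /
        (2 * 4 ^ (r + 1) * ((k : ℝ) + 1) ^ 3)) := fun k =>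
    mul_nonneg (by positivity) (div_nonneg
      (mul_nonneg (nestedSum_nonneg _ _) (sinMomentRatio_nonneg _ _)) (by positivity))
  rw [MZV_eq_toReal_mzvAbove, mzvAbove_replicate_append, ← h.tsum_eq,
    ← ENNReal.toReal_ofReal (tsum_nonneg hnn), ENNReal.ofReal_tsum_of_nonneg hnn h.summable]
  congr 1
  refine tsum_congr fun k => ?_
  rw [mzvAbove_replicate_two, zetaWeight, ← ENNReal.ofReal_mul (by positivity),
    ← ENNReal.ofReal_mul (nestedSum_nonneg _ _)]
  congr 1
  push_cast
  field_simp
  ring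

lemma integral_pow_mul_coPow (m j : ℕ) :
    ∫ x in 0..π / 2, x ^ m * coPow j x
      = (π / 2) ^ (m + j + 1) / ∏ i ∈ Icc (m + 1) (m + j + 1), (i : ℝ) := by
  induction j generalizing m with
  | zero => simp
  | succ j ih =>
    have h : ∫ x in 0..π / 2, ((m + 1) * (x ^ m * coPow (j + 1) x)
        - x ^ (m + 1) * coPow j x : ℝ) = 0 := by
      rw [intervalIntegral.integral_eq_sub_of_hasDerivAt
        (f := fun x => x ^ (m + 1) * coPow (j + 1) x) _
          (Continuous.intervalIntegrable (by fun_prop) _ _)]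
      · simp
      · intro x _
        refine ((hasDerivAt_pow (m + 1) x).mul (hasDerivAt_coPow_succ j x)).congr_deriv ?_
        push_cast
        ring
    rw [intervalIntegral.integral_sub (Continuous.intervalIntegrable (by fun_prop) _ _)
      (Continuous.intervalIntegrable (by fun_prop) _ _), intervalIntegral.integral_const_mul,
      ih (m + 1), sub_eq_zero] at h
    rw [← mul_right_inj' (by positivity : (m + 1 : ℝ) ≠ 0), h,
      ← Finset.mul_prod_Ioc_eq_prod_Icc (a := m + 1) (by omega : m + 1 ≤ m + (j + 1) + 1),
      show Ioc (m + 1) (m + (j + 1) + 1) = Icc (m + 1 + 1) (m + 1 + j + 1) by ext; simp; omega,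
      show m + (j + 1) + 1 = m + 1 + j + 1 by ring]
    push_cast
    field_simp

/-- The value `ζ(2n)` as a real number, with `ζ(0) = -1/2`. -/
noncomputable def zetaEven (n : ℕ) : ℝ :=
  if n = 0 then -1 / 2 else ∑' k : ℕ, 1 / ((k : ℝ) + 1) ^ (2 * n)

lemma riemannZeta_two_mul_eq_zetaEven (n : ℕ) : riemannZeta (2 * n) = (zetaEven n : ℂ) := by
  rcases Nat.eq_zero_or_pos n with rfl | hn
  · simp [zetaEven, riemannZeta_zero]
  · have h := zeta_nat_eq_tsum_of_gt_one (k := 2 * n) (by omega)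
    have hsum : Summable fun k : ℕ => 1 / (k : ℂ) ^ (2 * n) := by
      simpa using Complex.ofRealCLM.summable
        (Real.summable_one_div_nat_pow.2 (by omega : 1 < 2 * n))
    rw [hsum.tsum_eq_zero_add] at h
    rw [zetaEven, if_neg hn.ne', Complex.ofReal_tsum]
    push_cast at h ⊢
    rw [h]
    simp [hn.ne']

lemma summable_one_div_nat_succ_pow {p : ℕ} (hp : 1 < p) :
    Summable fun k : ℕ => 1 / ((k : ℝ) + 1) ^ p := by
  exact_mod_cast (summable_nat_add_iff 1).2 (Real.summable_one_div_nat_pow.2 hp)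

lemma abs_zetaEven_le (n : ℕ) : |zetaEven n| ≤ 1 + zetaEven 1 := by
  have h1 : zetaEven 1 = ∑' k : ℕ, 1 / ((k : ℝ) + 1) ^ 2 := by simp [zetaEven]
  have h1nn : 0 ≤ zetaEven 1 := h1 ▸ tsum_nonneg fun k => by positivity
  rcases Nat.eq_zero_or_pos n with rfl | hn
  · rw [zetaEven, if_pos rfl, abs_of_nonpos (by norm_num)]
    linarith
  · rw [zetaEven, if_neg hn.ne', abs_of_nonneg (tsum_nonneg fun k => by positivity)]
    refine le_trans ?_ (le_add_of_nonneg_left zero_le_one)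
    rw [h1]
    refine Summable.tsum_le_tsum (fun k => ?_) (summable_one_div_nat_succ_pow (by omega))
      (summable_one_div_nat_succ_pow (by omega))
    gcongr
    · linarith [(Nat.cast_nonneg k : (0 : ℝ) ≤ k)]
    · omega

lemma hasSum_cot_partial_fractions {z : ℝ} (h0 : 0 < z) (h1 : z < 1) :
    HasSum (fun k : ℕ => z ^ 2 / (((k : ℝ) + 1) ^ 2 - z ^ 2))
      (1 / 2 - π * z / 2 * (cos (π * z) / sin (π * z))) := by
  have hz : (z : ℂ) ∈ Complex.integerComplement := by
    rintro ⟨n, hn⟩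
    have hn' : (n : ℝ) = z := by exact_mod_cast hn
    rw [← hn'] at h0 h1
    have h0' : 0 < n := by exact_mod_cast h0
    have h1' : n < 1 := by exact_mod_cast h1
    omega
  have h := (summable_cotTerm hz).hasSum
  rw [← cot_series_rep' hz] at h
  have h2 := h.mul_left (-(z : ℂ) / 2)
  rw [← Complex.hasSum_ofReal]
  have hz0 : (z : ℂ) ≠ 0 := by exact_mod_cast h0.ne'
  convert! h2 using 1
  · ext k
    have ha : ((z : ℂ) - (k + 1)) ≠ 0 := by
      have : z - (k + 1) ≠ 0 := by linarith [(Nat.cast_nonneg k : (0 : ℝ) ≤ k)]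
      exact_mod_cast this
    have hb : ((z : ℂ) + (k + 1)) ≠ 0 := by
      have : z + (k + 1) ≠ 0 := by positivity
      exact_mod_cast this
    have hc : (((k : ℂ) + 1) ^ 2 - z ^ 2) ≠ 0 := by
      rw [show ((k : ℂ) + 1) ^ 2 - z ^ 2 = -((z - (k + 1)) * (z + (k + 1))) by ring]
      exact neg_ne_zero.2 (mul_ne_zero ha hb)
    rw [cotTerm]
    push_cast
    field_simp
    ring
  · rw [Complex.cot_eq_cos_div_sin]
    push_cast
    field_simp
    ring

lemma hasSum_zetaEven_mul_pow {z : ℝ} (h0 : 0 < z) (h1 : z < 1) :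
    HasSum (fun n : ℕ => zetaEven n * z ^ (2 * n))
      (-(π * z / 2 * (cos (π * z) / sin (π * z)))) := by
  have hpf := hasSum_cot_partial_fractions h0 h1
  have hgeo : ∀ k : ℕ, HasSum (fun n : ℕ => (z / ((k : ℝ) + 1)) ^ (2 * (n + 1)))
      (z ^ 2 / (((k : ℝ) + 1) ^ 2 - z ^ 2)) := fun k => by
    have hk : z < (k : ℝ) + 1 := by linarith [(Nat.cast_nonneg k : (0 : ℝ) ≤ k)]
    have hq : (z / ((k : ℝ) + 1)) ^ 2 < 1 :=
      pow_lt_one₀ (by positivity) ((div_lt_one (by positivity)).2 hk) two_ne_zero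
    have hd : ((k : ℝ) + 1) ^ 2 - z ^ 2 ≠ 0 := by nlinarith
    convert! (hasSum_geometric_of_lt_one (by positivity) hq).mul_left ((z / ((k : ℝ) + 1)) ^ 2)
      using 1
    · ext n
      ring
    · rw [div_pow, one_sub_div (by positivity), inv_div]
      field_simp
  have hnn : ∀ p : ℕ × ℕ, 0 ≤ (z / ((p.1 : ℝ) + 1)) ^ (2 * (p.2 + 1)) := fun p => by positivity
  have hsum : Summable fun p : ℕ × ℕ => (z / ((p.1 : ℝ) + 1)) ^ (2 * (p.2 + 1)) :=
    (summable_prod_of_nonneg hnn).2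
      ⟨fun k => (hgeo k).summable, by simpa only [(hgeo _).tsum_eq] using hpf.summable⟩
  have htot := hsum.hasSum
  rw [(htot.prod_fiberwise hgeo).unique hpf] at htot
  have hcol : ∀ n : ℕ, HasSum (fun k : ℕ => (z / ((k : ℝ) + 1)) ^ (2 * (n + 1)))
      (zetaEven (n + 1) * z ^ (2 * (n + 1))) := fun n => by
    rw [zetaEven, if_neg (Nat.succ_ne_zero n)]
    refine ((summable_one_div_nat_succ_pow (by omega : 1 < 2 * (n + 1))).hasSum.mul_right
      _).congr_fun fun k => ?_
    rw [div_pow]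
    ring
  have hfin := ((Equiv.prodComm ℕ ℕ).hasSum_iff.2 htot).prod_fiberwise hcol
  have := (hasSum_nat_add_iff (f := fun n : ℕ => zetaEven n * z ^ (2 * n)) 1).1 hfin
  convert! this using 1
  simp [zetaEven]
  ring

lemma hasSum_zetaEven_integral (r s : ℕ) :
    HasSum (fun n : ℕ => zetaEven n /
        ((∏ i ∈ Icc (2 * n + 2 * r + 2) (2 * n + 2 * r + 2 * s + 3), (i : ℝ)) * 2 ^ (2 * n)))
      (-((2 * r + 2)! / 2) * (2 / π) ^ (2 * r + 2 * s + 3) *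
        ∫ x in 0..π / 2, x ^ (2 * r + 2) / (2 * r + 2)! *
          (coPow (2 * s + 1) x * (cos x / sin x))) := by
  have hF : HasSum
      (fun n : ℕ => ∫ x in 0..π / 2, zetaEven n * (x / π) ^ (2 * n) *
        (x ^ (2 * r + 1) * coPow (2 * s + 1) x))
      (∫ x in 0..π / 2, -(x / 2 * (cos x / sin x)) * (x ^ (2 * r + 1) * coPow (2 * s + 1) x)) := by
    refine intervalIntegral.hasSum_integral_of_dominated_convergence
      (fun n x => (1 + zetaEven 1) * (1 / 4) ^ n * |x ^ (2 * r + 1) * coPow (2 * s + 1) x|)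
      (fun n => Continuous.aestronglyMeasurable (by fun_prop))
      (fun n => ae_of_all _ fun x hx => ?_) (ae_of_all _ fun x _ => ?_) ?_
      (ae_of_all _ fun x hx => ?_)
    · rw [Set.uIoc_of_le (by positivity)] at hx
      have hx0 := hx.1
      rw [norm_mul, norm_mul, Real.norm_eq_abs, Real.norm_eq_abs, Real.norm_eq_abs,
        abs_of_nonneg (by positivity : 0 ≤ (x / π) ^ (2 * n)), pow_mul]
      have hq : (x / π) ^ 2 ≤ 1 / 4 := by
        have : x / π ≤ 1 / 2 := by
          rw [div_le_iff₀ pi_pos]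
          linarith [hx.2]
        calc (x / π) ^ 2 ≤ (1 / 2) ^ 2 := by gcongr
          _ = 1 / 4 := by norm_num
      have hz := abs_zetaEven_le n
      have := (abs_nonneg _).trans hz
      gcongr
    · exact ((summable_geometric_of_lt_one (by norm_num) (by norm_num)).mul_left _).mul_right _
    · simp only [tsum_mul_right]
      exact Continuous.intervalIntegrable (by fun_prop) _ _
    · rw [Set.uIoc_of_le (by positivity)] at hx
      have h := hasSum_zetaEven_mul_pow (z := x / π) (div_pos hx.1 pi_pos)
        ((div_lt_one pi_pos).2 (by linarith [hx.2, pi_pos]))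
      rw [mul_div_cancel₀ _ pi_ne_zero] at h
      exact h.mul_right _
  have hG := hF.mul_left ((2 / π) ^ (2 * r + 2 * s + 3))
  convert! hG using 1
  · ext n
    have hterm : ∀ x : ℝ, zetaEven n * (x / π) ^ (2 * n) *
        (x ^ (2 * r + 1) * coPow (2 * s + 1) x) = zetaEven n / π ^ (2 * n) *
          (x ^ (2 * n + 2 * r + 1) * coPow (2 * s + 1) x) := fun x => by
      rw [div_pow]
      ring
    simp only [hterm]
    rw [intervalIntegral.integral_const_mul, integral_pow_mul_coPow,
      show 2 * n + 2 * r + 1 + (2 * s + 1) + 1 = 2 * n + (2 * r + 2 * s + 3) by ring,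
      show 2 * n + 2 * r + 2 * s + 3 = 2 * n + (2 * r + 2 * s + 3) by ring,
      pow_add (π / 2), div_pow, div_pow, div_pow]
    field_simp
  · rw [← intervalIntegral.integral_const_mul, ← intervalIntegral.integral_const_mul]
    refine intervalIntegral.integral_congr fun x _ => ?_
    field_simp
    ring

theorem stmt_8 (r s : ℕ) :
    (MZV (List.replicate r 2 ++ 3 :: List.replicate s 2) : ℂ) =
      (-4 * (Real.pi : ℂ) ^ (2 * r + 2 * s + 2) / (Nat.factorial (2 * r + 2) : ℂ)) *
        ∑' n : ℕ, riemannZeta (2 * n) /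
          ((∏ i ∈ Finset.Icc (2 * n + 2 * r + 2) (2 * n + 2 * r + 2 * s + 3), (i : ℂ))
            * 2 ^ (2 * n)) := by
  have h := Complex.hasSum_ofReal.2 (hasSum_zetaEven_integral r s)
  rw [MZV_replicate_two_three]
  simp only [riemannZeta_two_mul_eq_zetaEven]
  push_cast at h ⊢
  rw [h.tsum_eq]
  have hpi : (π : ℂ) ≠ 0 := by exact_mod_cast Real.pi_ne_zero
  have hfac : ((2 * r + 2)! : ℂ) ≠ 0 := by exact_mod_cast Nat.factorial_ne_zero _
  rw [show (4 : ℂ) = 2 ^ 2 by norm_num, ← pow_mul, div_pow]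
  field_simp
  ring
end
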